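/- arXiv:2105.13410 — 6 statements merged into one kernel-verified Lean document; each statement's English description precedes it below -/
import Mathlib

section
/- On the complex vector space with standard basis e_{(x₁,x₂,y)} indexed by (ZMod 2)³, define: H₃ e_{(x₁,x₂,y)} = (1/√2)(e_{(x₁,x₂,0)} + (−1)^y e_{(x₁,x₂,1)}); T₃ e_{(x₁,x₂,y)} = ω^y e_{(x₁,x₂,y)} with ω = exp(π i/4) (so the eigenvalue is 1 if y = 0 and ω if y = 1), and T₃⁻¹ its inverse; CX₁₃ e_{(x₁,x₂,y)} = e_{(x₁,x₂,y+x₁)}; CX₂₃ e_{(x₁,x₂,y)} = e_{(x₁,x₂,y+x₂)}. Then applying in sequence (first to last) H₃, T₃⁻¹, CX₂₃, T₃, CX₁₃, T₃⁻¹, CX₂₃, T₃, CX₁₃, H₃ to e_{(x₁,x₂,y)} yields i^{x₁·x₂} e_{(x₁,x₂, y + x₁·x₂)}; i.e., this Clifford+T circuit implements the doubly-controlled iX gate Λ₂(iX). -/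
/-- Standard basis vector of the complex vector space over index type `ι`. -/
noncomputable def e {ι : Type*} [DecidableEq ι] (j : ι) : ι → ℂ := Pi.single j 1

/-- `(−1)^b` for a bit `b`. -/
def m1 (b : ZMod 2) : ℂ := if b = 0 then 1 else -1

/-- `i^b` for a bit `b`. -/
def iPow (b : ZMod 2) : ℂ := if b = 0 then 1 else Complex.I

/-- The primitive eighth root of unity `ω = exp(π i / 4)`. -/
noncomputable def omega : ℂ := Complex.exp (Real.pi * Complex.I / 4)

/-- `ω^b` for a bit `b`. -/
noncomputable def omegaPow (b : ZMod 2) : ℂ := if b = 0 then 1 else omega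

theorem ZMod.two_eq_zero_or_one (b : ZMod 2) : b = 0 ∨ b = 1 := by
  decide +revert

theorem omega_mul_self : omega * omega = Complex.I := by
  refine Eq.trans ?_ Complex.exp_pi_div_two_mul_I
  rw [omega, ← Complex.exp_add]
  congr 1
  ring

theorem omega_ne_zero : omega ≠ 0 := Complex.exp_ne_zero _

theorem m1_add (a b : ZMod 2) : m1 (a + b) = m1 a * m1 b := by
  rcases a.two_eq_zero_or_one with rfl | rfl <;>
    rcases b.two_eq_zero_or_one with rfl | rfl <;>
    simp [m1, CharTwo.add_self_eq_zero]

/-- The phase accumulated by the alternating `T` gates is that of the doubly-controlled `iZ`. -/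
theorem omegaPow_phase (x₁ x₂ y : ZMod 2) :
    (omegaPow y)⁻¹ * omegaPow (y + x₂) * (omegaPow (y + x₂ + x₁))⁻¹ *
      omegaPow (y + x₂ + x₁ + x₂) = iPow (x₁ * x₂) * m1 (x₁ * x₂ * y) := by
  have hω := omega_ne_zero
  have hinv : omega⁻¹ * omega⁻¹ = -Complex.I := by
    rw [← mul_inv, omega_mul_self, Complex.inv_I]
  rcases x₁.two_eq_zero_or_one with rfl | rfl <;>
    rcases x₂.two_eq_zero_or_one with rfl | rfl <;>
    rcases y.two_eq_zero_or_one with rfl | rfl <;>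
    simp [omegaPow, iPow, m1, CharTwo.add_self_eq_zero, hω, hinv, omega_mul_self]

/-- The Hadamard gate conjugates `Z ^ b` to `X ^ b`. -/
theorem hadamard_sum {V : Type*} [AddCommGroup V] [Module ℂ V] (v : ZMod 2 → V) (b : ZMod 2) :
    ((Real.sqrt 2 : ℂ))⁻¹ • ((Real.sqrt 2 : ℂ))⁻¹ •
      ((v 0 + v 1) + m1 b • (v 0 - v 1)) = v b := by
  have h : ((Real.sqrt 2 : ℂ))⁻¹ * ((Real.sqrt 2 : ℂ))⁻¹ = 2⁻¹ := by
    rw [← mul_inv, ← Complex.ofReal_mul, Real.mul_self_sqrt zero_le_two, Complex.ofReal_ofNat]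
  rw [smul_smul, h]
  rcases b.two_eq_zero_or_one with rfl | rfl
  · simp only [m1, if_true]
    module
  · simp only [m1, one_ne_zero, if_false]
    module

/-- the Clifford+T circuit
`H₃, T₃⁻¹, CX₂₃, T₃, CX₁₃, T₃⁻¹, CX₂₃, T₃, CX₁₃, H₃` (applied first to last)
implements the doubly-controlled `iX` gate:
`e_{(x₁,x₂,y)} ↦ i^{x₁x₂} e_{(x₁,x₂,y+x₁x₂)}`. -/
theorem selinger_doubly_controlled_iX
    (H₃ T₃ T₃inv CX₁₃ CX₂₃ :
      ((ZMod 2 × ZMod 2 × ZMod 2) → ℂ) →ₗ[ℂ] ((ZMod 2 × ZMod 2 × ZMod 2) → ℂ))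
    (hH : ∀ x₁ x₂ y : ZMod 2,
      H₃ (e (x₁, x₂, y)) =
        ((Real.sqrt 2 : ℂ))⁻¹ • (e (x₁, x₂, 0) + m1 y • e (x₁, x₂, 1)))
    (hT : ∀ x₁ x₂ y : ZMod 2, T₃ (e (x₁, x₂, y)) = omegaPow y • e (x₁, x₂, y))
    (hTinv : ∀ x₁ x₂ y : ZMod 2,
      T₃inv (e (x₁, x₂, y)) = (omegaPow y)⁻¹ • e (x₁, x₂, y))
    (hCX₁₃ : ∀ x₁ x₂ y : ZMod 2, CX₁₃ (e (x₁, x₂, y)) = e (x₁, x₂, y + x₁))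
    (hCX₂₃ : ∀ x₁ x₂ y : ZMod 2, CX₂₃ (e (x₁, x₂, y)) = e (x₁, x₂, y + x₂)) :
    ∀ x₁ x₂ y : ZMod 2,
      H₃ (CX₁₃ (T₃ (CX₂₃ (T₃inv (CX₁₃ (T₃ (CX₂₃ (T₃inv (H₃ (e (x₁, x₂, y))))))))))) =
        iPow (x₁ * x₂) • e (x₁, x₂, y + x₁ * x₂) := by
  intro x₁ x₂ y
  have hD (z : ZMod 2) :
      CX₁₃ (T₃ (CX₂₃ (T₃inv (CX₁₃ (T₃ (CX₂₃ (T₃inv (e (x₁, x₂, z))))))))) =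
        (iPow (x₁ * x₂) * m1 (x₁ * x₂ * z)) • e (x₁, x₂, z) := by
    have hz : z + x₂ + x₁ + x₂ + x₁ = z := by
      linear_combination CharTwo.add_self_eq_zero x₁ + CharTwo.add_self_eq_zero x₂
    simp only [hT, hTinv, hCX₁₃, hCX₂₃, map_smul, smul_smul, hz, ← omegaPow_phase]
  rw [← hadamard_sum (fun z => e (x₁, x₂, z)) (y + x₁ * x₂), hH]
  simp only [map_smul, map_add, hD, hH, mul_zero, mul_one, m1_add]
  simp only [m1, one_ne_zero, if_true, if_false]
  module
end

section
/- On the complex vector space with standard basis e_{(x₁,x₂,a,y)} indexed by (ZMod 2)⁴ (controls x₁,x₂; ancilla a; target y), define: Λ₂(iX) e_{(x₁,x₂,a,y)} = i^{x₁·x₂} e_{(x₁,x₂,a + x₁·x₂,y)}; S†ₐ e_{(x₁,x₂,a,y)} = (−i)^a e_{(x₁,x₂,a,y)}; CX(a→y) e_{(x₁,x₂,a,y)} = e_{(x₁,x₂,a,y+a)}; and Hₐ the Hadamard on the ancilla, Hₐ e_{(x₁,x₂,a,y)} = (1/√2)(e_{(x₁,x₂,0,y)} + (−1)^a e_{(x₁,x₂,1,y)}).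 For all x₁, x₂, y ∈ ZMod 2 and each measurement outcome z ∈ ZMod 2: applying in sequence Λ₂(iX), S†ₐ, CX(a→y), Hₐ to e_{(x₁,x₂,0,y)}, then extracting the component with ancilla value z, then multiplying by the classically-controlled correction phase (−1)^{z·x₁·x₂}, yields exactly (1/√2) e_{(x₁,x₂,z, y + x₁·x₂)}. In particular both measurement outcomes occur with probability 1/2 and, after correction, Jones's measurement-assisted circuit implements the Toffoli gate. -/
/-- `(−i)^b` for a bit `b`. -/
def negiPow (b : ZMod 2) : ℂ := if b = 0 then 1 else -Complex.I

/-- The state space on controls `x₁,x₂`, ancilla `a`, target `y`. -/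
abbrev V7 := (ZMod 2 × ZMod 2 × ZMod 2 × ZMod 2) → ℂ

/-- Jones's measurement-assisted Toffoli.  Applying
`Λ₂(iX), S†ₐ, CX(a→y), Hₐ` to `e_{(x₁,x₂,0,y)}`, projecting onto ancilla value `z`,
and multiplying by the classically-controlled correction `(−1)^{z·x₁·x₂}` yields
`(1/√2) e_{(x₁,x₂,z, y+x₁x₂)}`. -/
theorem jones_measurement_assisted_toffoli
    (Lam Sdag CX Ha : V7 →ₗ[ℂ] V7) (P : ZMod 2 → (V7 →ₗ[ℂ] V7))
    (hLam : ∀ x₁ x₂ a y : ZMod 2,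
      Lam (e (x₁, x₂, a, y)) = iPow (x₁ * x₂) • e (x₁, x₂, a + x₁ * x₂, y))
    (hS : ∀ x₁ x₂ a y : ZMod 2,
      Sdag (e (x₁, x₂, a, y)) = negiPow a • e (x₁, x₂, a, y))
    (hCX : ∀ x₁ x₂ a y : ZMod 2, CX (e (x₁, x₂, a, y)) = e (x₁, x₂, a, y + a))
    (hHa : ∀ x₁ x₂ a y : ZMod 2,
      Ha (e (x₁, x₂, a, y)) =
        ((Real.sqrt 2 : ℂ))⁻¹ • (e (x₁, x₂, 0, y) + m1 a • e (x₁, x₂, 1, y)))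
    (hP : ∀ (z x₁ x₂ a y : ZMod 2),
      P z (e (x₁, x₂, a, y)) = if a = z then e (x₁, x₂, a, y) else 0) :
    ∀ x₁ x₂ y z : ZMod 2,
      m1 (z * x₁ * x₂) • P z (Ha (CX (Sdag (Lam (e (x₁, x₂, 0, y)))))) =
        ((Real.sqrt 2 : ℂ))⁻¹ • e (x₁, x₂, z, y + x₁ * x₂) := by
  intro x₁ x₂ y z
  have phase (b : ZMod 2) : iPow b * negiPow b = 1 := by
    by_cases hb : b = 0 <;> simp [iPow, negiPow, hb]
  have correction (b : ZMod 2) : m1 b * m1 b = 1 := by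
    by_cases hb : b = 0 <;> simp [m1, hb]
  rw [mul_assoc z, hLam, zero_add]
  generalize x₁ * x₂ = b
  rw [map_smul, hS, smul_smul, phase, one_smul, hCX, hHa, map_smul, map_add, map_smul, hP, hP]
  obtain rfl | rfl : z = 0 ∨ z = 1 := by revert z; decide
  · simp [m1]
  · rw [if_neg (by decide), if_pos rfl, zero_add, one_mul, smul_comm, smul_smul (m1 b),
      correction, one_smul]
end

section
/- Let n ∈ ℕ, f : (Fin n → ZMod 2) → ZMod 2, and c : (Fin n → ZMod 2) → ℂ. On the complex vector space with standard basis e_{(x,y)} indexed by (Fin n → ZMod 2) × ZMod 2, consider the state v = Σ_x c x · e_{(x, f x)} holding the temporary value f x. Apply the Hadamard to the last qubit (e_{(x,y)} ↦ (1/√2)(e_{(x,0)} + (−1)^y e_{(x,1)})). Then for each measurement outcome z ∈ ZMod 2, the resulting vector's component with last qubit equal to z, viewed as the vector w_z = Σ_x w_z x · e_x in the space indexed by Fin n → ZMod 2, equals (1/√2) Σ_x (−1)^{z · f x} c x · e_x; consequently, applying the classically-controlled diagonal correction e_x ↦ (−1)^{z · f x} e_x to w_z yields (1/√2) Σ_x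 c x · e_x. Thus a temporary value can be terminated by an X-basis measurement followed by a classically-controlled (−1)^{f} phase correction. -/
theorem e_apply {ι : Type*} [DecidableEq ι] (i j : ι) :
    e i j = if j = i then 1 else 0 :=
  Pi.single_apply i 1 j

theorem m1_mul_self (b : ZMod 2) : m1 b * m1 b = 1 := by
  unfold m1; split_ifs <;> norm_num

theorem sum_smul_e_apply {ι : Type*} [Fintype ι] [DecidableEq ι] (a : ι → ℂ) (i : ι) :
    (∑ j, a j • e j) i = a i := by
  simp [Finset.sum_apply, e_apply]

/-- The unnormalized Hadamard image of `e (a, y)` has amplitude `(-1)^(z * y)` at `(a, z)`,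
and `0` at `(x, z)` for `x ≠ a`. -/
theorem hadamard_amplitude {ι : Type*} [DecidableEq ι] (x a : ι) (y z : ZMod 2) :
    (e (a, 0) + m1 y • e (a, 1) : ι × ZMod 2 → ℂ) (x, z) =
      if x = a then m1 (z * y) else 0 := by
  have hz : z = 0 ∨ z = 1 := by revert z; decide
  rcases hz with rfl | rfl <;> by_cases hy : y = 0 <;> simp [e_apply, m1, hy, apply_ite]

/-- measurement-assisted termination of a temporary value.
Starting from `v = Σ_x c x • e_{(x, f x)}`, applying the Hadamard `H` to the last
qubit, the component with last qubit `z` (viewed in the space indexed by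
`Fin n → ZMod 2`) equals `(1/√2) Σ_x (−1)^{z·f x} c x • e_x`; applying the
classically-controlled diagonal correction `e_x ↦ (−1)^{z·f x} e_x` then yields
`(1/√2) Σ_x c x • e_x`. -/
theorem measurement_assisted_termination
    (n : ℕ) (f : (Fin n → ZMod 2) → ZMod 2) (c : (Fin n → ZMod 2) → ℂ)
    (H : ((Fin n → ZMod 2) × ZMod 2 → ℂ) →ₗ[ℂ] ((Fin n → ZMod 2) × ZMod 2 → ℂ))
    (hH : ∀ (x : Fin n → ZMod 2) (y : ZMod 2),
      H (e (x, y)) = ((Real.sqrt 2 : ℂ))⁻¹ • (e (x, 0) + m1 y • e (x, 1))) :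
    ∀ z : ZMod 2,
      (fun x : Fin n → ZMod 2 => H (∑ x', c x' • e (x', f x')) (x, z)) =
          ((Real.sqrt 2 : ℂ))⁻¹ • ∑ x, (m1 (z * f x) * c x) • e x ∧
      (fun x : Fin n → ZMod 2 =>
          m1 (z * f x) * H (∑ x', c x' • e (x', f x')) (x, z)) =
          ((Real.sqrt 2 : ℂ))⁻¹ • ∑ x, c x • e x := by
  have amplitude (x : Fin n → ZMod 2) (z : ZMod 2) :
      H (∑ x', c x' • e (x', f x')) (x, z) =
        ((Real.sqrt 2 : ℂ))⁻¹ * (m1 (z * f x) * c x) := by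
    simp only [map_sum, map_smul, hH, Finset.sum_apply, Pi.smul_apply,
      hadamard_amplitude, smul_eq_mul, mul_ite, mul_zero, Finset.sum_ite_eq,
      Finset.mem_univ, if_true]
    ring
  intro z
  constructor <;> funext x <;>
    rw [amplitude, Pi.smul_apply, sum_smul_e_apply, smul_eq_mul]
  linear_combination ((Real.sqrt 2 : ℂ))⁻¹ * c x * m1_mul_self (z * f x)
end

section
/- Let k ∈ ℕ and f, g : (Fin k → ZMod 2) → ZMod 2. On the complex vector space with standard basis e_{(x,a,b,y)} indexed by (Fin k → ZMod 2) × ZMod 2 × ZMod 2 × ZMod 2 (input x, ancillas a and b, target y), define: U_f^{(a)} e_{(x,a,b,y)} = e_{(x, a + f x, b, y)} and its inverse U_f^{(a)†}; U_g^{(b)} e_{(x,a,b,y)} = e_{(x, a, b + g x, y)}; CCX(a,b→y) e_{(x,a,b,y)} = e_{(x,a,b, y + a·b)}; H_b e_{(x,a,b,y)} = (1/√2)(e_{(x,a,0,y)} + (−1)^b e_{(x,a,1,y)}). Then applying in sequence (first to last) U_f^{(a)} together with H_b, then CCX(a,b→y), then U_g^{(b)}, then CCX(a,b→y), then H_b together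 with U_f^{(a)†}, maps e_{(x,0,0,y)} to e_{(x,0,0, y + f x · g x)} for all x and y. That is, this circuit is an exact oracle for the product f·g, computing U_g only once and returning both ancillas clean. -/
/-- The state space on input `x`, ancillas `a, b`, target `y`. -/
abbrev V10 (k : ℕ) := ((Fin k → ZMod 2) × ZMod 2 × ZMod 2 × ZMod 2) → ℂ

/-- the oracle-multiplication circuit
`(U_f^{(a)}, H_b), CCX(a,b→y), U_g^{(b)}, CCX(a,b→y), (H_b, U_f^{(a)†})`
is an exact oracle for the product `f·g`, computing `U_g` only once and
returning both ancillas clean. -/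
theorem oracle_multiplication_with_ancillas
    (k : ℕ) (f g : (Fin k → ZMod 2) → ZMod 2)
    (Uf Ufdag Ug CCX Hb : V10 k →ₗ[ℂ] V10 k)
    (hUf : ∀ (x : Fin k → ZMod 2) (a b y : ZMod 2),
      Uf (e (x, a, b, y)) = e (x, a + f x, b, y))
    (hUfdag : ∀ (x : Fin k → ZMod 2) (a b y : ZMod 2),
      Ufdag (e (x, a + f x, b, y)) = e (x, a, b, y))
    (hUg : ∀ (x : Fin k → ZMod 2) (a b y : ZMod 2),
      Ug (e (x, a, b, y)) = e (x, a, b + g x, y))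
    (hCCX : ∀ (x : Fin k → ZMod 2) (a b y : ZMod 2),
      CCX (e (x, a, b, y)) = e (x, a, b, y + a * b))
    (hHb : ∀ (x : Fin k → ZMod 2) (a b y : ZMod 2),
      Hb (e (x, a, b, y)) =
        ((Real.sqrt 2 : ℂ))⁻¹ • (e (x, a, 0, y) + m1 b • e (x, a, 1, y))) :
    ∀ (x : Fin k → ZMod 2) (y : ZMod 2),
      Ufdag (Hb (CCX (Ug (CCX (Hb (Uf (e (x, 0, 0, y)))))))) =
        e (x, 0, 0, y + f x * g x) := by
  intro x y
  have two : (1 : ZMod 2) + 1 = 0 := by decide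
  have hsqrt : ((Real.sqrt 2 : ℂ))⁻¹ * ((Real.sqrt 2 : ℂ))⁻¹ = 1 / 2 := by
    rw [← mul_inv, ← Complex.ofReal_mul, Real.mul_self_sqrt zero_le_two]
    norm_num
  have hm0 : m1 0 = 1 := by simp [m1]
  have hm1 : m1 1 = -1 := by simp [m1]
  -- Applying the Hadamard gate to the uniform superposition returns the ancilla to `0`.
  have hHplus : ∀ a z : ZMod 2,
      Hb (((Real.sqrt 2 : ℂ))⁻¹ • (e (x, a, 0, z) + e (x, a, 1, z))) = e (x, a, 0, z) := by
    intro a z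
    rw [map_smul, map_add, hHb, hHb, hm0, hm1, ← smul_add, smul_smul, hsqrt]
    module
  -- The two Toffoli gates around `Ug` add `f x * g x` to the target in each branch.
  have hphase : ∀ b : ZMod 2,
      CCX (Ug (CCX (e (x, f x, b, y)))) = e (x, f x, b + g x, y + f x * g x) := by
    intro b
    have hbit : ∀ p q r s : ZMod 2, s + p * r + p * (r + q) = s + p * q := by decide
    rw [hCCX, hUg, hCCX, hbit]
  have hswap : e (x, f x, 0 + g x, y + f x * g x) + e (x, f x, 1 + g x, y + f x * g x) =
      (e (x, f x, 0, y + f x * g x) + e (x, f x, 1, y + f x * g x) : V10 k) := by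
    have hbits : ∀ q : ZMod 2, q = 0 ∨ q = 1 := by decide
    rcases hbits (g x) with h | h <;> rw [h]
    · simp only [add_zero]
    · rw [two, zero_add, add_comm]
  have hUfdag_zero := hUfdag x 0 0 (y + f x * g x)
  rw [zero_add] at hUfdag_zero
  rw [hUf, zero_add, hHb, hm0, one_smul]
  simp only [map_smul, map_add, hphase]
  rw [← map_add Ufdag, ← map_add Hb, hswap, ← map_smul Ufdag, ← map_smul Hb, hHplus, hUfdag_zero]
end

section
/- Let k ∈ ℕ and f, g : (Fin k → ZMod 2) → ZMod 2. On the complex vector space with standard basis e_{(x,y)} indexed by (Fin k → ZMod 2) × ZMod 2, define: U_f e_{(x,y)} = e_{(x, y + f x)}, U_g e_{(x,y)} = e_{(x, y + g x)}, T e_{(x,y)} = ω^y e_{(x,y)} with ω = exp(π i/4) (eigenvalue 1 if y = 0 and ω if y = 1) with inverse T⁻¹, and H the Hadamard on the last qubit. Then applying in sequence (first to last) H, T, U_f, T⁻¹, U_g, T, U_f, T⁻¹, U_g, H maps e_{(x,y)} to (−i)^{f x · g x} e_{(x, y + f x · g x)}. That is, matched ancilla-free oracle multiplication implements the oracle for f·g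 up to a phase depending only on the controls. -/
theorem omega_inv_mul_omega_inv : omega⁻¹ * omega⁻¹ = -Complex.I := by
  rw [← mul_inv, omega_mul_self, Complex.inv_I]

/-- The phase that the alternating `T` and `T⁻¹` gates accumulate on the basis state `z`. -/
theorem omegaPow_commutator_phase (a b z : ZMod 2) :
    (omegaPow (z + a + b + a))⁻¹ * omegaPow (z + a + b) * (omegaPow (z + a))⁻¹ * omegaPow z =
      negiPow (a * b) * m1 (z * (a * b)) := by
  have h2 : (1 : ZMod 2) + 1 = 0 := by decide
  have hbit : ∀ c : ZMod 2, c = 0 ∨ c = 1 := by decide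
  rcases hbit a with rfl | rfl <;> rcases hbit b with rfl | rfl <;>
    rcases hbit z with rfl | rfl <;>
    simp [omegaPow, negiPow, m1, h2, omega_ne_zero, omega_mul_self, omega_inv_mul_omega_inv]

theorem inv_sqrt_two_mul_self : ((Real.sqrt 2 : ℂ))⁻¹ * ((Real.sqrt 2 : ℂ))⁻¹ = 1 / 2 := by
  rw [← mul_inv, ← Complex.ofReal_mul, Real.mul_self_sqrt (by norm_num)]
  norm_num

/-- matched ancilla-free oracle multiplication.  The sequence
`H, T, U_f, T⁻¹, U_g, T, U_f, T⁻¹, U_g, H` (first to last) maps `e_{(x,y)}` to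
`(−i)^{f x · g x} e_{(x, y + f x · g x)}`. -/
theorem matched_oracle_multiplication
    (k : ℕ) (f g : (Fin k → ZMod 2) → ZMod 2)
    (Uf Ug T Tinv H : ((Fin k → ZMod 2) × ZMod 2 → ℂ) →ₗ[ℂ]
      ((Fin k → ZMod 2) × ZMod 2 → ℂ))
    (hUf : ∀ (x : Fin k → ZMod 2) (y : ZMod 2), Uf (e (x, y)) = e (x, y + f x))
    (hUg : ∀ (x : Fin k → ZMod 2) (y : ZMod 2), Ug (e (x, y)) = e (x, y + g x))
    (hT : ∀ (x : Fin k → ZMod 2) (y : ZMod 2), T (e (x, y)) = omegaPow y • e (x, y))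
    (hTinv : ∀ (x : Fin k → ZMod 2) (y : ZMod 2),
      Tinv (e (x, y)) = (omegaPow y)⁻¹ • e (x, y))
    (hH : ∀ (x : Fin k → ZMod 2) (y : ZMod 2),
      H (e (x, y)) = ((Real.sqrt 2 : ℂ))⁻¹ • (e (x, 0) + m1 y • e (x, 1))) :
    ∀ (x : Fin k → ZMod 2) (y : ZMod 2),
      H (Ug (Tinv (Uf (T (Ug (Tinv (Uf (T (H (e (x, y))))))))))) =
        negiPow (f x * g x) • e (x, y + f x * g x) := by
  have hmid : ∀ (x : Fin k → ZMod 2) (z : ZMod 2),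
      Ug (Tinv (Uf (T (Ug (Tinv (Uf (T (e (x, z))))))))) =
        (negiPow (f x * g x) * m1 (z * (f x * g x))) • e (x, z) := by
    intro x z
    have hz : z + f x + g x + f x + g x = z := by
      linear_combination CharTwo.add_self_eq_zero (f x) + CharTwo.add_self_eq_zero (g x)
    rw [← omegaPow_commutator_phase]
    simp only [hT, hUf, hTinv, hUg, map_smul, smul_smul, hz]
    congr 1
    ring
  intro x y
  rw [hH]
  simp only [map_smul, map_add, hmid, hH]
  generalize f x * g x = c
  have h2 : (1 : ZMod 2) + 1 = 0 := by decide
  have hbit : ∀ c : ZMod 2, c = 0 ∨ c = 1 := by decide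
  ext i
  have hs := inv_sqrt_two_mul_self
  rcases hbit c with rfl | rfl <;> rcases hbit y with rfl | rfl <;>
    simp only [negiPow, m1, h2, mul_zero, mul_one, add_zero, zero_add, one_ne_zero,
      if_true, if_false, Pi.add_apply, Pi.smul_apply, smul_eq_mul]
  · linear_combination (2 * e (x, (0 : ZMod 2)) i) * hs
  · linear_combination (2 * e (x, (1 : ZMod 2)) i) * hs
  · linear_combination (-2 * Complex.I * e (x, (1 : ZMod 2)) i) * hs
  · linear_combination (-2 * Complex.I * e (x, (0 : ZMod 2)) i) * hs
end

section
/- On the complex vector space with standard basis e_{(x₁,x₂,x₃,x₄,a,b,y)} indexed by (ZMod 2)⁷ (controls x₁,…,x₄, dirty ancillas a and b, target y), let Hₐ and H_b denote Hadamards on a and b, and let Tof(u,v→w) denote the Toffoli adding u·v to w. Then applying in sequence (first to last) Hₐ, H_b, Tof(x₄,b→y), Tof(x₃,a→b), Tof(x₁,x₂→a), Tof(x₃,a→b), Tof(x₄,b→y), Hₐ, H_b maps e_{(x₁,x₂,x₃,x₄,a,b,y)} to (−1)^{a·x₁·x₂ + b·x₁·x₂·x₃} · e_{(x₁,x₂,x₃,x₄,a,b,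 y + x₁·x₂·x₃·x₄)}. That is, trading the uncomputation of the two dirty ancillas for Hadamard conjugation yields a relative-phase 4-controlled NOT whose phase is (−1)^{a x₁x₂ + b x₁x₂x₃}. -/
set_option synthInstance.maxSize 400

/-- State space on controls `x₁,…,x₄`, dirty ancillas `a, b`, target `y`. -/
abbrev V16 :=
  (ZMod 2 × ZMod 2 × ZMod 2 × ZMod 2 × ZMod 2 × ZMod 2 × ZMod 2) → ℂ

/-- trading the uncomputation of the two dirty ancillas for Hadamard
conjugation yields a relative-phase 4-controlled NOT.  The sequence (first to last)
`Hₐ, H_b, Tof(x₄,b→y), Tof(x₃,a→b), Tof(x₁,x₂→a), Tof(x₃,a→b), Tof(x₄,b→y), Hₐ, H_b`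
maps `e_{(x₁,x₂,x₃,x₄,a,b,y)}` to
`(−1)^{a x₁x₂ + b x₁x₂x₃} e_{(x₁,x₂,x₃,x₄,a,b, y + x₁x₂x₃x₄)}`. -/
theorem relative_phase_four_controlled_not_dirty_ancillas
    (Ha Hb Tof1 Tof2 Tof3 : V16 →ₗ[ℂ] V16)
    (hHa : ∀ x₁ x₂ x₃ x₄ a b y : ZMod 2,
      Ha (e (x₁, x₂, x₃, x₄, a, b, y)) =
        ((Real.sqrt 2 : ℂ))⁻¹ •
          (e (x₁, x₂, x₃, x₄, 0, b, y) + m1 a • e (x₁, x₂, x₃, x₄, 1, b, y)))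
    (hHb : ∀ x₁ x₂ x₃ x₄ a b y : ZMod 2,
      Hb (e (x₁, x₂, x₃, x₄, a, b, y)) =
        ((Real.sqrt 2 : ℂ))⁻¹ •
          (e (x₁, x₂, x₃, x₄, a, 0, y) + m1 b • e (x₁, x₂, x₃, x₄, a, 1, y)))
    (hTof1 : ∀ x₁ x₂ x₃ x₄ a b y : ZMod 2,
      Tof1 (e (x₁, x₂, x₃, x₄, a, b, y)) = e (x₁, x₂, x₃, x₄, a, b, y + x₄ * b))
    (hTof2 : ∀ x₁ x₂ x₃ x₄ a b y : ZMod 2,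
      Tof2 (e (x₁, x₂, x₃, x₄, a, b, y)) = e (x₁, x₂, x₃, x₄, a, b + x₃ * a, y))
    (hTof3 : ∀ x₁ x₂ x₃ x₄ a b y : ZMod 2,
      Tof3 (e (x₁, x₂, x₃, x₄, a, b, y)) = e (x₁, x₂, x₃, x₄, a + x₁ * x₂, b, y)) :
    ∀ x₁ x₂ x₃ x₄ a b y : ZMod 2,
      Hb (Ha (Tof1 (Tof2 (Tof3 (Tof2 (Tof1 (Hb (Ha (e (x₁, x₂, x₃, x₄, a, b, y)))))))))) =
        m1 (a * x₁ * x₂ + b * x₁ * x₂ * x₃) •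
          e (x₁, x₂, x₃, x₄, a, b, y + x₁ * x₂ * x₃ * x₄) := by
  intro x₁ x₂ x₃ x₄ a b y
  have middle (a b : ZMod 2) :
      Tof1 (Tof2 (Tof3 (Tof2 (Tof1 (e (x₁, x₂, x₃, x₄, a, b, y)))))) =
        e (x₁, x₂, x₃, x₄, a + x₁ * x₂, b + x₁ * x₂ * x₃, y + x₁ * x₂ * x₃ * x₄) := by
    have h2 (t : ZMod 2) : t + t = 0 := CharTwo.add_self_eq_zero t
    have hb : b + x₃ * a + x₃ * (a + x₁ * x₂) = b + x₁ * x₂ * x₃ := by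
      linear_combination h2 (x₃ * a)
    have hy : y + x₄ * b + x₄ * (b + x₁ * x₂ * x₃) = y + x₁ * x₂ * x₃ * x₄ := by
      linear_combination h2 (x₄ * b)
    simp only [hTof1, hTof2, hTof3, hb, hy]
  have hs : ((Real.sqrt 2 : ℂ))⁻¹ ^ 4 = 1 / 4 := by
    have h : (Real.sqrt 2 : ℂ) ^ 2 = 2 := by
      exact_mod_cast congrArg Complex.ofReal (Real.sq_sqrt (zero_le_two (α := ℝ)))
    rw [inv_pow, show (Real.sqrt 2 : ℂ) ^ 4 = ((Real.sqrt 2 : ℂ) ^ 2) ^ 2 by ring, h]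
    norm_num
  have bit (t : ZMod 2) : t = 0 ∨ t = 1 := by
    revert t
    decide
  have m1_zero : m1 0 = 1 := by simp [m1]
  have m1_one : m1 1 = -1 := by simp [m1]
  have one_add : (1 + 1 : ZMod 2) = 0 := by decide
  simp only [hHa, hHb, map_smul, map_add, middle, mul_assoc a x₁ x₂,
    show b * x₁ * x₂ * x₃ = b * (x₁ * x₂ * x₃) by ring]
  generalize x₁ * x₂ * x₃ * x₄ = z
  generalize x₁ * x₂ * x₃ = d
  generalize x₁ * x₂ = c
  generalize ((Real.sqrt 2 : ℂ))⁻¹ = s at hs ⊢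
  rcases bit a with rfl | rfl <;> rcases bit b with rfl | rfl <;>
    rcases bit c with rfl | rfl <;> rcases bit d with rfl | rfl <;>
    simp only [m1_zero, m1_one, one_add, add_zero, zero_add, mul_zero, mul_one] <;>
    match_scalars <;> first | ring1 | linear_combination 4 * hs | linear_combination -4 * hs
end
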